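/- For n ≥ 1 let ℓ_n be the critical length of L_n = D^{n+1} + D^{n−1} (kernel spanned by 1, x, …, x^{n−2}, cos x, sin x), let S_n ∈ ker L_n be the solution with S_n(0) = ⋯ = S_n^{(n−1)}(0) = 0 and S_n^{(n)}(0) = 1, and for 0 ≤ k ≤ n−1 let W_k(h) := det((S_n^{(i+j)}(h))_{0 ≤ i,j ≤ k}). Set p := ⌊(n−1)/2⌋. Then ℓ_n = inf{h > 0 : W_p(h) = 0} (the first positive zero of W_p), and for every 0 ≤ k < p the Wronskian W_k has no zero in (0, +∞). -/

import Mathlib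

open scoped BigOperators

noncomputable section

/-- `F` vanishes to order at least `m` at `x`: all derivatives of order `< m` vanish at `x`. -/
def VanishAtLeast (F : ℝ → ℝ) (m : ℕ) (x : ℝ) : Prop :=
  ∀ j < m, iteratedDeriv j F x = 0

/-- `F` vanishes at most `N` times in `J`, counting multiplicities up to `μ`. -/
def VanishAtMost (F : ℝ → ℝ) (μ N : ℕ) (J : Set ℝ) : Prop :=
  ∀ (r : ℕ) (xs : Fin r → ℝ) (m : Fin r → ℕ),
    (∀ i, xs i ∈ J) → Function.Injective xs →
    (∀ i, 1 ≤ m i) → (∀ i, m i ≤ μ) →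
    (∀ i, VanishAtLeast F (m i) (xs i)) →
    ∑ i, m i ≤ N

/-- Kernel of the operator `L = D^(n+1) + ∑_{i=0}^n a i • D^i`. -/
def kerOp (n : ℕ) (a : Fin (n + 1) → ℝ) : Set (ℝ → ℝ) :=
  {F | ContDiff ℝ (⊤ : ℕ∞) F ∧
    ∀ x : ℝ, iteratedDeriv (n + 1) F x + ∑ i : Fin (n + 1), a i * iteratedDeriv (i : ℕ) F x = 0}

/-- The (restriction of the) kernel of `L` is an Extended Chebyshev space on `J`. -/
def IsECOn (n : ℕ) (a : Fin (n + 1) → ℝ) (J : Set ℝ) : Prop :=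
  ∀ F ∈ kerOp n a, F ≠ 0 → VanishAtMost F (n + 1) n J

/-- Critical length of the operator `L = D^(n+1) + ∑ a i • D^i`, as an extended real. -/
def critLen (n : ℕ) (a : Fin (n + 1) → ℝ) : EReal :=
  sSup {l : EReal | ∃ h : ℝ, l = (h : EReal) ∧ 0 < h ∧ IsECOn n a (Set.Icc 0 h)}

/-- The Wronskian of `(S, S', …, S^(k))` at `h`, i.e. `det ((S^(i+j)(h))_{0 ≤ i,j ≤ k})`. -/
def WronS (S : ℝ → ℝ) (k : ℕ) (h : ℝ) : ℝ :=
  (Matrix.of fun i j : Fin (k + 1) => iteratedDeriv ((i : ℕ) + (j : ℕ)) S h).det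

/-- Coefficient vector of the cycloidal operator `L_n = D^(n+1) + D^(n-1)`,
whose kernel is spanned by `1, x, …, x^(n-2), cos x, sin x`. -/
def trigCoeff (m : ℕ) : Fin (m + 1) → ℝ := fun i => if (i : ℕ) = m - 1 then 1 else 0


/-! ### Rolle with multiplicities and Pólya's theorem -/

lemma VanishAtLeast.deriv {F : ℝ → ℝ} {m : ℕ} {x : ℝ} (h : VanishAtLeast F m x) :
    VanishAtLeast (deriv F) (m - 1) x := by
  intro j hj
  rw [← iteratedDeriv_succ']
  exact h (j + 1) (by omega)

lemma VanishAtLeast.val {F : ℝ → ℝ} {m : ℕ} {x : ℝ} (h : VanishAtLeast F m x) (hm : 1 ≤ m) :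
    F x = 0 := by
  simpa using h 0 hm

lemma VanishAtLeast.mono {F : ℝ → ℝ} {m k : ℕ} {x : ℝ} (h : VanishAtLeast F m x) (hm : k ≤ m) :
    VanishAtLeast F k x := fun j hj => h j (by omega)

lemma VanishAtLeast.congr {F G : ℝ → ℝ} {m : ℕ} {x : ℝ} (h : VanishAtLeast F m x)
    (hFG : F =ᶠ[nhds x] G) : VanishAtLeast G m x := by
  intro j hj
  rw [← hFG.iteratedDeriv_eq j]
  exact h j hj

lemma VanishAtLeast.mul {F G : ℝ → ℝ} {m : ℕ} {x : ℝ} (h : VanishAtLeast F m x)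
    (hF : ContDiffAt ℝ (⊤ : ℕ∞) F x) (hG : ContDiffAt ℝ (⊤ : ℕ∞) G x) :
    VanishAtLeast (F * G) m x := by
  intro j hj
  rw [iteratedDeriv_mul (hF.of_le (by exact_mod_cast le_top)) (hG.of_le (by exact_mod_cast le_top))]
  apply Finset.sum_eq_zero
  intro i hi
  rw [h i (by have := Finset.mem_range.1 hi; omega)]
  simp

lemma rolle_mult {F : ℝ → ℝ} {I : Set ℝ} (hI : I.OrdConnected) (hF : ContinuousOn F I)
    (μ : ℝ → ℕ) (T : Finset ℝ) : T.Nonempty →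
    (∀ x ∈ T, x ∈ I ∧ 1 ≤ μ x ∧ VanishAtLeast F (μ x) x) →
    ∃ (T' : Finset ℝ) (μ' : ℝ → ℕ),
      (∀ x ∈ T', (x ∈ I ∧ 1 ≤ μ' x ∧ VanishAtLeast (deriv F) (μ' x) x) ∧ ∃ y ∈ T, x ≤ y) ∧
      ∑ x ∈ T, μ x ≤ ∑ x ∈ T', μ' x + 1 := by
  induction T using Finset.induction_on_max with
  | empty => intro h; simp at h
  | insert a T0 ha ih =>
    intro _ hT
    have haT : a ∉ T0 := fun h => lt_irrefl _ (ha a h)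
    obtain ⟨haI, ha1, haV⟩ := hT a (Finset.mem_insert_self _ _)
    rcases T0.eq_empty_or_nonempty with h0 | h0
    · subst h0
      by_cases h2 : 2 ≤ μ a
      · refine ⟨{a}, fun _ => μ a - 1, ?_, ?_⟩
        · intro x hx
          rw [Finset.mem_singleton] at hx
          subst hx
          exact ⟨⟨haI, (by show 1 ≤ μ x - 1; omega), haV.deriv⟩, x, by simp, le_rfl⟩
        · simp; omega
      · refine ⟨∅, fun _ => 0, by simp, ?_⟩
        simp; omega
    · obtain ⟨T1, μ1, h1, hs⟩ := ih h0 (fun x hx => hT x (Finset.mem_insert_of_mem hx))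
      set b := T0.max' h0 with hb
      have hbT : b ∈ T0 := Finset.max'_mem _ _
      obtain ⟨hbI, hb1, hbV⟩ := hT b (Finset.mem_insert_of_mem hbT)
      obtain ⟨ξ, hξ, hξ0⟩ := exists_deriv_eq_zero (ha b hbT) (hF.mono (hI.out hbI haI))
        ((hbV.val hb1).trans (haV.val ha1).symm)
      have hT1 : ∀ x ∈ T1, x ≤ b := by
        intro x hx
        obtain ⟨y, hy, hxy⟩ := (h1 x hx).2
        exact hxy.trans (Finset.le_max' _ _ hy)
      have hξT : ξ ∉ T1 := fun h => absurd (hT1 _ h) (not_le.2 hξ.1)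
      have haT1 : a ∉ T1 := fun h => absurd (hT1 _ h) (not_le.2 (ha b hbT))
      have hξa : ξ ≠ a := hξ.2.ne
      have hξI : ξ ∈ I := hI.out hbI haI ⟨hξ.1.le, hξ.2.le⟩
      have hξV : VanishAtLeast (deriv F) 1 ξ := by
        intro j hj
        obtain rfl : j = 0 := by omega
        simpa using hξ0
      set μ' : ℝ → ℕ := fun x => if x = a then μ a - 1 else if x = ξ then 1 else μ1 x with hμ'
      have e1 : μ' a = μ a - 1 := by simp [hμ']
      have e2 : μ' ξ = 1 := by simp [hμ', hξa]
      have e3 : ∀ x ∈ T1, μ' x = μ1 x := by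
        intro x hx
        have hxa : x ≠ a := fun h => haT1 (h ▸ hx)
        have hxξ : x ≠ ξ := fun h => hξT (h ▸ hx)
        simp [hμ', hxa, hxξ]
      have e4 : ∑ x ∈ T1, μ' x = ∑ x ∈ T1, μ1 x := Finset.sum_congr rfl e3
      have key : ∀ x ∈ insert ξ T1,
          (x ∈ I ∧ 1 ≤ μ' x ∧ VanishAtLeast (deriv F) (μ' x) x) ∧ ∃ y ∈ insert a T0, x ≤ y := by
        intro x hx
        rcases Finset.mem_insert.1 hx with rfl | hx
        · rw [e2]
          exact ⟨⟨hξI, le_rfl, hξV⟩, a, Finset.mem_insert_self _ _, hξ.2.le⟩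
        · rw [e3 x hx]
          exact ⟨(h1 x hx).1, b, Finset.mem_insert_of_mem hbT, hT1 x hx⟩
      by_cases h2 : 2 ≤ μ a
      · refine ⟨insert a (insert ξ T1), μ', ?_, ?_⟩
        · intro x hx
          rcases Finset.mem_insert.1 hx with rfl | hx
          · rw [e1]
            exact ⟨⟨haI, by omega, haV.deriv⟩, x, Finset.mem_insert_self _ _, le_rfl⟩
          · exact key x hx
        · rw [Finset.sum_insert haT, Finset.sum_insert (by simp [hξa.symm, haT1]),
            Finset.sum_insert hξT, e1, e2, e4]
          omega
      · refine ⟨insert ξ T1, μ', key, ?_⟩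
        rw [Finset.sum_insert haT, Finset.sum_insert hξT, e2, e4]
        omega

/-- A finite set of zeros with multiplicities. -/
def ZerosIn (F : ℝ → ℝ) (I : Set ℝ) (T : Finset ℝ) (μ : ℝ → ℕ) : Prop :=
  ∀ x ∈ T, x ∈ I ∧ 1 ≤ μ x ∧ VanishAtLeast F (μ x) x

lemma rolle_count {F : ℝ → ℝ} {I : Set ℝ} (hI : I.OrdConnected) (hF : ContinuousOn F I)
    {μ : ℝ → ℕ} {T : Finset ℝ} {N : ℕ} (hT : ZerosIn F I T μ) (hN : N + 1 ≤ ∑ x ∈ T, μ x) :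
    ∃ (T' : Finset ℝ) (μ' : ℝ → ℕ), ZerosIn (deriv F) I T' μ' ∧ N ≤ ∑ x ∈ T', μ' x := by
  have hne : T.Nonempty := by
    rcases T.eq_empty_or_nonempty with h | h
    · subst h; simp at hN
    · exact h
  obtain ⟨T', μ', h1, h2⟩ := rolle_mult hI hF μ T hne hT
  exact ⟨T', μ', fun x hx => (h1 x hx).1, by omega⟩

lemma exists_zero_of_count {F : ℝ → ℝ} {I : Set ℝ} {μ : ℝ → ℕ} {T : Finset ℝ} {N : ℕ}
    (hT : ZerosIn F I T μ) (hN : N + 1 ≤ ∑ x ∈ T, μ x) : ∃ x ∈ I, F x = 0 := by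
  rcases T.eq_empty_or_nonempty with h | ⟨x, hx⟩
  · subst h; simp at hN
  · obtain ⟨h1, h2, h3⟩ := hT x hx
    exact ⟨x, h1, h3.val h2⟩

/-- Linear combination `∑_{i ≤ m} c_i U_i`. -/
def comb (U : ℕ → ℝ → ℝ) (c : ℕ → ℝ) (m : ℕ) : ℝ → ℝ :=
  fun x => ∑ i ∈ Finset.range (m + 1), c i * U i x

lemma comb_contDiffOn {U : ℕ → ℝ → ℝ} {c : ℕ → ℝ} {m : ℕ} {I : Set ℝ}
    (hU : ∀ i ≤ m, ContDiffOn ℝ (⊤ : ℕ∞) (U i) I) : ContDiffOn ℝ (⊤ : ℕ∞) (comb U c m) I := by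
  unfold comb
  apply ContDiffOn.sum
  intro i hi
  exact contDiffOn_const.mul (hU i (by have := Finset.mem_range.1 hi; omega))

lemma polya {I : Set ℝ} (hI : I.OrdConnected) (hIo : IsOpen I) (m : ℕ) :
    ∀ (U : ℕ → ℝ → ℝ), (∀ i ≤ m, ContDiffOn ℝ (⊤ : ℕ∞) (U i) I) →
    (∀ j ≤ m, ∀ c : ℕ → ℝ, ∀ x ∈ I, VanishAtLeast (comb U c j) (j + 1) x → ∀ i ≤ j, c i = 0) →
    ∀ (c : ℕ → ℝ) (T : Finset ℝ) (μ : ℝ → ℕ), ZerosIn (comb U c m) I T μ →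
      m + 1 ≤ ∑ x ∈ T, μ x → ∀ i ≤ m, c i = 0 := by
  induction m with
  | zero =>
    intro U hU H c T μ hT hN
    obtain ⟨x, hx, hx0⟩ := exists_zero_of_count hT hN
    refine H 0 le_rfl c x hx ?_
    intro j hj
    obtain rfl : j = 0 := by omega
    simpa using hx0
  | succ m ih =>
    intro U hU H c T μ hT hN
    have hU0 : ∀ x ∈ I, U 0 x ≠ 0 := by
      intro x hx h
      have := H 0 (by omega) (fun _ => 1) x hx (by
        intro j hj
        obtain rfl : j = 0 := by omega
        simp [comb, h]) 0 le_rfl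
      simp at this
    have hUinv : ContDiffOn ℝ (⊤ : ℕ∞) (fun x => (U 0 x)⁻¹) I := (hU 0 (by omega)).inv hU0
    set Q : ℕ → ℝ → ℝ := fun i x => U (i + 1) x * (U 0 x)⁻¹ with hQ
    have hQs : ∀ i ≤ m, ContDiffOn ℝ (⊤ : ℕ∞) (Q i) I := fun i hi =>
      (hU (i + 1) (by omega)).mul hUinv
    set V : ℕ → ℝ → ℝ := fun i => deriv (Q i) with hV
    have hVs : ∀ i ≤ m, ContDiffOn ℝ (⊤ : ℕ∞) (V i) I := fun i hi =>
      (hQs i hi).deriv_of_isOpen hIo (by simp)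
    -- the quotient
    have hquot : ∀ (d : ℕ → ℝ) (j : ℕ), ∀ x ∈ I,
        (comb U d (j + 1) * fun x => (U 0 x)⁻¹) x = d 0 + comb Q (fun i => d (i + 1)) j x := by
      intro d j x hx
      simp only [Pi.mul_apply, comb, hQ]
      rw [Finset.sum_range_succ' _ (j + 1), add_mul, Finset.sum_mul, add_comm]
      congr 1
      · rw [mul_assoc, mul_inv_cancel₀ (hU0 x hx), mul_one]
      · apply Finset.sum_congr rfl; intros; ring
    have hnear : ∀ (d : ℕ → ℝ) (j : ℕ), ∀ x ∈ I,
        (comb U d (j + 1) * fun x => (U 0 x)⁻¹) =ᶠ[nhds x]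
          fun x => d 0 + comb Q (fun i => d (i + 1)) j x := by
      intro d j x hx
      filter_upwards [hIo.mem_nhds hx] with y hy
      exact hquot d j y hy
    have hcombV : ∀ (d : ℕ → ℝ) (j : ℕ), j ≤ m → ∀ x ∈ I, ∀ e : ℝ,
        deriv (fun x => e + comb Q d j x) x = comb V d j x := by
      intro d j hj x hx e
      have hd : ∀ i ∈ Finset.range (j + 1), HasDerivAt (fun x => d i * Q i x) (d i * V i x) x := by
        intro i hi
        have hi' : i ≤ m := by have := Finset.mem_range.1 hi; omega
        have h1 : DifferentiableAt ℝ (Q i) x :=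
          ((hQs i hi').contDiffAt (hIo.mem_nhds hx)).differentiableAt (by simp)
        exact h1.hasDerivAt.const_mul (d i)
      have := (HasDerivAt.fun_sum hd).const_add e
      exact this.deriv
    have hcombVn : ∀ (d : ℕ → ℝ) (j : ℕ), j ≤ m → ∀ x ∈ I, ∀ e : ℝ,
        deriv (fun x => e + comb Q d j x) =ᶠ[nhds x] comb V d j := by
      intro d j hj x hx e
      filter_upwards [hIo.mem_nhds hx] with y hy
      exact hcombV d j hj y hy e
    have hHV : ∀ j ≤ m, ∀ c : ℕ → ℝ, ∀ x ∈ I, VanishAtLeast (comb V c j) (j + 1) x →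
        ∀ i ≤ j, c i = 0 := by
      intro j hj d x hx hv
      set c' : ℕ → ℝ := fun i => Nat.casesOn i (-(comb Q d j x)) d with hc'
      have hq : VanishAtLeast (fun x => c' 0 + comb Q (fun i => c' (i + 1)) j x) (j + 2) x := by
        intro l hl
        rcases l with _ | l
        · simp [hc']
        · rw [iteratedDeriv_succ']
          exact (hv.congr (hcombVn d j hj x hx (c' 0)).symm) l (by omega)
      have hq2 := (hq.congr (hnear c' j x hx).symm)
      have hcs : ContDiffAt ℝ (⊤ : ℕ∞) (comb U c' (j + 1)) x :=
        (comb_contDiffOn (fun i hi => hU i (by omega))).contDiffAt (hIo.mem_nhds hx)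
      have his : ContDiffAt ℝ (⊤ : ℕ∞) (fun x => (U 0 x)⁻¹) x := hUinv.contDiffAt (hIo.mem_nhds hx)
      have hus : ContDiffAt ℝ (⊤ : ℕ∞) (U 0) x := (hU 0 (by omega)).contDiffAt (hIo.mem_nhds hx)
      have hq3 := hq2.mul (hcs.mul his) hus
      have hq4 : VanishAtLeast (comb U c' (j + 1)) (j + 2) x := by
        refine hq3.congr ?_
        filter_upwards [hIo.mem_nhds hx] with y hy
        simp only [Pi.mul_apply]
        rw [mul_assoc, inv_mul_cancel₀ (hU0 y hy), mul_one]
      intro i hi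
      exact H (j + 1) (by omega) c' x hx hq4 (i + 1) (by omega)
    -- zeros of the quotient
    have hG : ZerosIn (fun x => c 0 + comb Q (fun i => c (i + 1)) m x) I T μ := by
      intro x hx
      obtain ⟨h1, h2, h3⟩ := hT x hx
      refine ⟨h1, h2, ?_⟩
      have hcs : ContDiffAt ℝ (⊤ : ℕ∞) (comb U c (m + 1)) x :=
        (comb_contDiffOn (fun i hi => hU i (by omega))).contDiffAt (hIo.mem_nhds h1)
      exact (h3.mul hcs (hUinv.contDiffAt (hIo.mem_nhds h1))).congr (hnear c m x h1)
    have hGc : ContinuousOn (fun x => c 0 + comb Q (fun i => c (i + 1)) m x) I :=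
      continuousOn_const.add (comb_contDiffOn (fun i hi => hQs i (by omega))).continuousOn
    obtain ⟨T', μ', hT', hN'⟩ := rolle_count hI hGc hG hN
    have hT'' : ZerosIn (comb V (fun i => c (i + 1)) m) I T' μ' := by
      intro x hx
      obtain ⟨h1, h2, h3⟩ := hT' x hx
      exact ⟨h1, h2, h3.congr (hcombVn _ m le_rfl x h1 _)⟩
    have hc := ih V hVs hHV (fun i => c (i + 1)) T' μ' hT'' hN'
    have hc0 : c 0 = 0 := by
      obtain ⟨x, hx, hx0⟩ := exists_zero_of_count hT hN
      have : comb U c (m + 1) x = c 0 * U 0 x := by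
        unfold comb
        rw [Finset.sum_range_succ']
        rw [Finset.sum_eq_zero, zero_add]
        intro i hi
        have h := hc i (by have := Finset.mem_range.1 hi; omega)
        rw [h, zero_mul]
      rw [this] at hx0
      exact (mul_eq_zero.1 hx0).resolve_right (hU0 x hx)
    intro i hi
    rcases i with _ | i
    · exact hc0
    · exact hc i (by omega)

/-! ### Beta-weighted trigonometric moments -/

/-- Cosine transform on `[-1,1]`. -/
def Ic (φ : ℝ → ℝ) (s : ℝ) : ℝ := ∫ t in (-1 : ℝ)..1, φ t * Real.cos (s * t)

/-- Sine transform on `[-1,1]`. -/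
def Is (φ : ℝ → ℝ) (s : ℝ) : ℝ := ∫ t in (-1 : ℝ)..1, φ t * Real.sin (s * t)

lemma hasDerivAt_Ic {φ : ℝ → ℝ} (hφ : Continuous φ) (s : ℝ) :
    HasDerivAt (Ic φ) (-(Is (fun t => t * φ t) s)) s := by
  have h := intervalIntegral.hasDerivAt_integral_of_dominated_loc_of_deriv_le
    (μ := MeasureTheory.volume) (a := -1) (b := 1) (bound := fun t => |t * φ t|)
    (F := fun s t => φ t * Real.cos (s * t)) (F' := fun s t => -(t * φ t * Real.sin (s * t)))
    (x₀ := s) (s := Set.univ) Filter.univ_mem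
    (Filter.Eventually.of_forall fun x => (by fun_prop : Continuous
      fun t => φ t * Real.cos (x * t)).aestronglyMeasurable)
    ((by fun_prop : Continuous fun t => φ t * Real.cos (s * t)).intervalIntegrable _ _)
    ((by fun_prop : Continuous
      fun t => -(t * φ t * Real.sin (s * t))).aestronglyMeasurable)
    (Filter.Eventually.of_forall fun t _ x _ => by
      rw [norm_neg, Real.norm_eq_abs, abs_mul]
      exact mul_le_of_le_one_right (abs_nonneg _) (Real.abs_sin_le_one _))
    ((by fun_prop : Continuous fun t => |t * φ t|).intervalIntegrable _ _)
    (Filter.Eventually.of_forall fun t _ x _ => by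
      have h1 : HasDerivAt (fun x : ℝ => x * t) t x := by
        simpa using (hasDerivAt_id x).mul_const t
      have h2 := (h1.cos).const_mul (φ t)
      exact h2.congr_deriv (by ring))
  have h2 := h.2
  rw [intervalIntegral.integral_neg] at h2
  exact h2

lemma hasDerivAt_Is {φ : ℝ → ℝ} (hφ : Continuous φ) (s : ℝ) :
    HasDerivAt (Is φ) (Ic (fun t => t * φ t) s) s := by
  have h := intervalIntegral.hasDerivAt_integral_of_dominated_loc_of_deriv_le
    (μ := MeasureTheory.volume) (a := -1) (b := 1) (bound := fun t => |t * φ t|)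
    (F := fun s t => φ t * Real.sin (s * t)) (F' := fun s t => t * φ t * Real.cos (s * t))
    (x₀ := s) (s := Set.univ) Filter.univ_mem
    (Filter.Eventually.of_forall fun x => (by fun_prop : Continuous
      fun t => φ t * Real.sin (x * t)).aestronglyMeasurable)
    ((by fun_prop : Continuous fun t => φ t * Real.sin (s * t)).intervalIntegrable _ _)
    ((by fun_prop : Continuous
      fun t => t * φ t * Real.cos (s * t)).aestronglyMeasurable)
    (Filter.Eventually.of_forall fun t _ x _ => by
      rw [Real.norm_eq_abs, abs_mul]
      exact mul_le_of_le_one_right (abs_nonneg _) (Real.abs_cos_le_one _))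
    ((by fun_prop : Continuous fun t => |t * φ t|).intervalIntegrable _ _)
    (Filter.Eventually.of_forall fun t _ x _ => by
      have h1 : HasDerivAt (fun x : ℝ => x * t) t x := by
        simpa using (hasDerivAt_id x).mul_const t
      have h2 := (h1.sin).const_mul (φ t)
      exact h2.congr_deriv (by ring))
  exact h.2

/-- The beta weight. -/
def bw (α β : ℕ) (t : ℝ) : ℝ := (1 - t) ^ α * (1 + t) ^ β

lemma bw_cont (α β : ℕ) : Continuous (bw α β) := by unfold bw; fun_prop

/-- moments -/
def C0 (α β : ℕ) : ℝ → ℝ := Ic (bw α β)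
def C1 (α β : ℕ) : ℝ → ℝ := Ic (fun t => t * bw α β t)
def C2 (α β : ℕ) : ℝ → ℝ := Ic (fun t => t * (t * bw α β t))
def S0 (α β : ℕ) : ℝ → ℝ := Is (bw α β)
def S1 (α β : ℕ) : ℝ → ℝ := Is (fun t => t * bw α β t)
def S2 (α β : ℕ) : ℝ → ℝ := Is (fun t => t * (t * bw α β t))

section
variable (α β : ℕ) (s : ℝ)

lemma dC0 : HasDerivAt (C0 α β) (-(S1 α β s)) s := hasDerivAt_Ic (bw_cont α β) s
lemma dC1 : HasDerivAt (C1 α β) (-(S2 α β s)) s :=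
  hasDerivAt_Ic (continuous_id.mul (bw_cont α β)) s
lemma dS0 : HasDerivAt (S0 α β) (C1 α β s) s := hasDerivAt_Is (bw_cont α β) s
lemma dS1 : HasDerivAt (S1 α β) (C2 α β s) s :=
  hasDerivAt_Is (continuous_id.mul (bw_cont α β)) s

lemma Ic_sub {φ ψ : ℝ → ℝ} (hφ : Continuous φ) (hψ : Continuous ψ) :
    Ic (fun t => φ t - ψ t) s = Ic φ s - Ic ψ s := by
  unfold Ic
  rw [← intervalIntegral.integral_sub
    ((by fun_prop : Continuous fun t => φ t * Real.cos (s * t)).intervalIntegrable _ _)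
    ((by fun_prop : Continuous fun t => ψ t * Real.cos (s * t)).intervalIntegrable _ _)]
  congr 1; ext t; ring

lemma Is_sub {φ ψ : ℝ → ℝ} (hφ : Continuous φ) (hψ : Continuous ψ) :
    Is (fun t => φ t - ψ t) s = Is φ s - Is ψ s := by
  unfold Is
  rw [← intervalIntegral.integral_sub
    ((by fun_prop : Continuous fun t => φ t * Real.sin (s * t)).intervalIntegrable _ _)
    ((by fun_prop : Continuous fun t => ψ t * Real.sin (s * t)).intervalIntegrable _ _)]
  congr 1; ext t; ring

lemma Ic_const (a : ℝ) (φ : ℝ → ℝ) : Ic (fun t => a * φ t) s = a * Ic φ s := by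
  unfold Ic
  rw [← intervalIntegral.integral_const_mul]
  congr 1; ext t; ring

lemma Is_const (a : ℝ) (φ : ℝ → ℝ) : Is (fun t => a * φ t) s = a * Is φ s := by
  unfold Is
  rw [← intervalIntegral.integral_const_mul]
  congr 1; ext t; ring

lemma C0_succ : C0 (α + 1) β s = C0 α β s - C1 α β s := by
  have hc := bw_cont α β
  unfold C0 C1
  rw [← Ic_sub s hc (by fun_prop)]
  congr 1; ext t; simp only [bw]; ring

lemma C1_succ : C1 (α + 1) β s = C1 α β s - C2 α β s := by
  have hc := bw_cont α β
  unfold C1 C2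
  rw [← Ic_sub s (by fun_prop) (by fun_prop)]
  congr 1; ext t; simp only [bw]; ring

lemma S0_succ : S0 (α + 1) β s = S0 α β s - S1 α β s := by
  have hc := bw_cont α β
  unfold S0 S1
  rw [← Is_sub s hc (by fun_prop)]
  congr 1; ext t; simp only [bw]; ring

lemma S1_succ : S1 (α + 1) β s = S1 α β s - S2 α β s := by
  have hc := bw_cont α β
  unfold S1 S2
  rw [← Is_sub s (by fun_prop) (by fun_prop)]
  congr 1; ext t; simp only [bw]; ring

lemma bw_deriv (t : ℝ) : HasDerivAt (bw (α + 1) (β + 1))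
    (((β : ℝ) - α) * bw α β t - ((α : ℝ) + β + 2) * (t * bw α β t)) t := by
  have h1 : HasDerivAt (fun t : ℝ => (1 - t) ^ (α + 1)) (((α + 1 : ℕ) : ℝ) * (1 - t) ^ α * (-1)) t := by
    exact (((hasDerivAt_id t).const_sub 1).pow (α + 1)).congr_deriv (by simp)
  have h2 : HasDerivAt (fun t : ℝ => (1 + t) ^ (β + 1)) (((β + 1 : ℕ) : ℝ) * (1 + t) ^ β * 1) t := by
    exact (((hasDerivAt_id t).const_add 1).pow (β + 1)).congr_deriv (by simp)
  have := h1.mul h2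
  refine this.congr_deriv ?_
  unfold bw
  push_cast
  ring

lemma bw_succ_eq (t : ℝ) : bw (α + 1) (β + 1) t = bw α β t - t * (t * bw α β t) := by
  unfold bw; ring

lemma ode_S : s * S2 α β s = ((α : ℝ) - β) * C0 α β s + ((α : ℝ) + β + 2) * C1 α β s
    + s * S0 α β s := by
  have hc := bw_cont α β
  have hc' := bw_cont (α + 1) (β + 1)
  have h := intervalIntegral.integral_mul_deriv_eq_deriv_mul (a := -1) (b := 1)
    (u := fun t => Real.cos (s * t)) (u' := fun t => - (s * Real.sin (s * t)))
    (v := bw (α + 1) (β + 1))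
    (v' := fun t => ((β : ℝ) - α) * bw α β t - ((α : ℝ) + β + 2) * (t * bw α β t))
    (fun t _ => by
      have h1 : HasDerivAt (fun t : ℝ => s * t) s t := by
        simpa using (hasDerivAt_id t).const_mul s
      exact h1.cos.congr_deriv (by ring))
    (fun t _ => bw_deriv α β t)
    ((by fun_prop : Continuous fun t => - (s * Real.sin (s * t))).intervalIntegrable _ _)
    ((by fun_prop : Continuous fun t => ((β : ℝ) - α) * bw α β t -
      ((α : ℝ) + β + 2) * (t * bw α β t)).intervalIntegrable _ _)
  have e1 : bw (α + 1) (β + 1) 1 = 0 := by simp [bw]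
  have e2 : bw (α + 1) (β + 1) (-1) = 0 := by simp [bw]
  rw [e1, e2] at h
  have l1 : (∫ t in (-1 : ℝ)..1, Real.cos (s * t) * (((β : ℝ) - α) * bw α β t -
      ((α : ℝ) + β + 2) * (t * bw α β t))) =
      ((β : ℝ) - α) * C0 α β s - ((α : ℝ) + β + 2) * C1 α β s := by
    unfold C0 C1
    rw [← Ic_const, ← Ic_const, ← Ic_sub s (by fun_prop) (by fun_prop)]
    unfold Ic; congr 1; ext t; ring
  have l2 : (∫ t in (-1 : ℝ)..1, -(s * Real.sin (s * t)) * bw (α + 1) (β + 1) t) =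
      -(s * (S0 α β s - S2 α β s)) := by
    unfold S0 S2
    rw [← Is_sub s (by fun_prop) (by fun_prop), ← Is_const]
    unfold Is
    rw [← intervalIntegral.integral_neg]
    congr 1; ext t; rw [bw_succ_eq]; ring
  rw [l1, l2] at h
  linear_combination h

lemma ode_C : s * C2 α β s = s * C0 α β s - ((α : ℝ) - β) * S0 α β s
    - ((α : ℝ) + β + 2) * S1 α β s := by
  have hc := bw_cont α β
  have hc' := bw_cont (α + 1) (β + 1)
  have h := intervalIntegral.integral_mul_deriv_eq_deriv_mul (a := -1) (b := 1)
    (u := fun t => Real.sin (s * t)) (u' := fun t => (s * Real.cos (s * t)))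
    (v := bw (α + 1) (β + 1))
    (v' := fun t => ((β : ℝ) - α) * bw α β t - ((α : ℝ) + β + 2) * (t * bw α β t))
    (fun t _ => by
      have h1 : HasDerivAt (fun t : ℝ => s * t) s t := by
        simpa using (hasDerivAt_id t).const_mul s
      exact h1.sin.congr_deriv (by ring))
    (fun t _ => bw_deriv α β t)
    ((by fun_prop : Continuous fun t => (s * Real.cos (s * t))).intervalIntegrable _ _)
    ((by fun_prop : Continuous fun t => ((β : ℝ) - α) * bw α β t -
      ((α : ℝ) + β + 2) * (t * bw α β t)).intervalIntegrable _ _)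
  have e1 : bw (α + 1) (β + 1) 1 = 0 := by simp [bw]
  have e2 : bw (α + 1) (β + 1) (-1) = 0 := by simp [bw]
  rw [e1, e2] at h
  have l1 : (∫ t in (-1 : ℝ)..1, Real.sin (s * t) * (((β : ℝ) - α) * bw α β t -
      ((α : ℝ) + β + 2) * (t * bw α β t))) =
      ((β : ℝ) - α) * S0 α β s - ((α : ℝ) + β + 2) * S1 α β s := by
    unfold S0 S1
    rw [← Is_const, ← Is_const, ← Is_sub s (by fun_prop) (by fun_prop)]
    unfold Is; congr 1; ext t; ring
  have l2 : (∫ t in (-1 : ℝ)..1, (s * Real.cos (s * t)) * bw (α + 1) (β + 1) t) =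
      (s * (C0 α β s - C2 α β s)) := by
    unfold C0 C2
    rw [← Ic_sub s (by fun_prop) (by fun_prop), ← Ic_const]
    unfold Ic
    congr 1; ext t; rw [bw_succ_eq]; ring
  rw [l1, l2] at h
  linear_combination -h

/-- quadratic quantities -/
def qu : ℝ := C0 α β s ^ 2 + S0 α β s ^ 2
def qv : ℝ := S0 α β s * C1 α β s - C0 α β s * S1 α β s
def qw : ℝ := C1 α β s ^ 2 + S1 α β s ^ 2
def qr : ℝ := C0 α β s * C1 α β s + S0 α β s * S1 α β s
def qY : ℝ := ((α : ℝ) - β) * qu α β s + ((α : ℝ) + β + 2) * qr α β s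
def qX : ℝ := ((α : ℝ) + β + 2) * qw α β s - (2 * β + 2) * qr α β s - ((α : ℝ) - β) * qu α β s

lemma qv_succ : s * qv (α + 1) β s = - qX α β s := by
  unfold qv qX qu qw qr
  rw [C0_succ, C1_succ, S0_succ, S1_succ]
  linear_combination (C0 α β s - C1 α β s) * ode_S α β s - (S0 α β s - S1 α β s) * ode_C α β s

lemma hasDerivAt_qu : HasDerivAt (qu α β) (2 * qv α β s) s := by
  have := ((dC0 α β s).pow 2).add ((dS0 α β s).pow 2)
  refine this.congr_deriv ?_
  unfold qv
  push_cast; ring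

lemma hasDerivAt_qr : HasDerivAt (qr α β) (S0 α β s * C2 α β s - C0 α β s * S2 α β s) s := by
  have := ((dC0 α β s).mul (dC1 α β s)).add ((dS0 α β s).mul (dS1 α β s))
  refine this.congr_deriv ?_
  ring

lemma hasDerivAt_qw : HasDerivAt (qw α β) (2 * (S1 α β s * C2 α β s - C1 α β s * S2 α β s)) s := by
  have := ((dC1 α β s).pow 2).add ((dS1 α β s).pow 2)
  refine this.congr_deriv ?_
  push_cast; ring

lemma hasDerivAt_sY : HasDerivAt (fun s => s ^ (α + β + 2) * qY α β s)
    (2 * ((α : ℝ) - β) * s ^ (α + β + 2) * qv α β s) s := by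
  have h1 := ((hasDerivAt_qu α β s).const_mul ((α : ℝ) - β)).add
    ((hasDerivAt_qr α β s).const_mul ((α : ℝ) + β + 2))
  have h2 := (hasDerivAt_pow (α + β + 2) s).mul h1
  refine h2.congr_deriv ?_
  have e : α + β + 2 - 1 = α + β + 1 := by omega
  rw [e]
  simp only [Pi.add_apply, qu, qr, qv]
  push_cast
  have a1 := ode_S α β s
  have a2 := ode_C α β s
  rw [pow_succ s (α + β + 1)]
  linear_combination s ^ (α + β + 1) * ((α : ℝ) + β + 2) * (S0 α β s * a2 - C0 α β s * a1)

lemma hasDerivAt_sX : HasDerivAt (fun s => s ^ (2 * (α + β + 2)) * qX α β s)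
    (-2 * ((α : ℝ) + 1) * s ^ (2 * (α + β + 2) - 1) * (qY α β s + 2 * s * qv α β s)) s := by
  have h1 := (((hasDerivAt_qw α β s).const_mul ((α : ℝ) + β + 2)).sub
    ((hasDerivAt_qr α β s).const_mul (2 * (β : ℝ) + 2))).sub
    ((hasDerivAt_qu α β s).const_mul ((α : ℝ) - β))
  have h2 := (hasDerivAt_pow (2 * (α + β + 2)) s).mul h1
  refine h2.congr_deriv ?_
  have e : 2 * (α + β + 2) = (2 * (α + β + 2) - 1) + 1 := by omega
  have e' : s ^ (2 * (α + β + 2)) = s ^ (2 * (α + β + 2) - 1) * s := by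
    conv_lhs => rw [e, pow_succ]
  rw [e']
  simp only [Pi.sub_apply, qY, qu, qr, qv, qw]
  push_cast
  have a1 := ode_S α β s
  have a2 := ode_C α β s
  generalize s ^ (2 * (α + β + 2) - 1) = P
  linear_combination P * ((((α : ℝ) + β + 2) * 2 * (S1 α β s * a2 - C1 α β s * a1)) -
    (2 * (β : ℝ) + 2) * (S0 α β s * a2 - C0 α β s * a1))

end

/-- main induction step -/
lemma qv_step {α β : ℕ} (hαβ : β < α) (h1 : ∀ s, 0 < s → qv α β s ≤ 0)
    (h2 : ∀ s, 0 < s → s < 1 → qv α β s < 0) : ∀ s, 0 < s → qv (α + 1) β s < 0 := by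
  have hd : (0 : ℝ) < (α : ℝ) - β := by
    have : (β : ℝ) < α := by exact_mod_cast hαβ
    linarith
  have hcY : Continuous (fun s => s ^ (α + β + 2) * qY α β s) :=
    continuous_iff_continuousAt.2 fun s => (hasDerivAt_sY α β s).continuousAt
  have hcX : Continuous (fun s => s ^ (2 * (α + β + 2)) * qX α β s) :=
    continuous_iff_continuousAt.2 fun s => (hasDerivAt_sX α β s).continuousAt
  have hanti : AntitoneOn (fun s => s ^ (α + β + 2) * qY α β s) (Set.Ici 0) := by
    apply antitoneOn_of_deriv_nonpos (convex_Ici 0) hcY.continuousOn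
    · intro s _; exact (hasDerivAt_sY α β s).differentiableAt.differentiableWithinAt
    · intro s hs
      rw [interior_Ici] at hs
      have hs' : 0 < s := hs
      rw [(hasDerivAt_sY α β s).deriv]
      have := h1 s hs
      have : 0 < 2 * ((α : ℝ) - β) * s ^ (α + β + 2) := by positivity
      exact mul_nonpos_of_nonneg_of_nonpos this.le (h1 s hs)
  have hsanti : StrictAntiOn (fun s => s ^ (α + β + 2) * qY α β s) (Set.Icc 0 1) := by
    apply strictAntiOn_of_deriv_neg (convex_Icc 0 1) hcY.continuousOn
    intro s hs
    rw [interior_Icc] at hs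
    have hs' : 0 < s := hs.1
    rw [(hasDerivAt_sY α β s).deriv]
    have : 0 < 2 * ((α : ℝ) - β) * s ^ (α + β + 2) := by positivity
    exact mul_neg_of_pos_of_neg this (h2 s hs.1 hs.2)
  have hY : ∀ s, 0 < s → qY α β s < 0 := by
    intro s hs
    have : s ^ (α + β + 2) * qY α β s < 0 := by
      rcases le_or_gt s 1 with h | h
      · have := hsanti (Set.left_mem_Icc.2 zero_le_one) ⟨hs.le, h⟩ hs
        simpa using this
      · have a := hsanti (Set.left_mem_Icc.2 zero_le_one) (Set.right_mem_Icc.2 zero_le_one) one_pos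
        have b := hanti (Set.mem_Ici.2 zero_le_one) (Set.mem_Ici.2 hs.le) h.le
        have := lt_of_le_of_lt b a
        simpa using this
    exact neg_of_mul_neg_right this (by positivity)
  have hX : StrictMonoOn (fun s => s ^ (2 * (α + β + 2)) * qX α β s) (Set.Ici 0) := by
    apply strictMonoOn_of_deriv_pos (convex_Ici 0) hcX.continuousOn
    intro s hs
    rw [interior_Ici] at hs
    have hs' : 0 < s := hs
    rw [(hasDerivAt_sX α β s).deriv]
    have a := hY s hs
    have b := h1 s hs
    have c : 0 < 2 * ((α : ℝ) + 1) * s ^ (2 * (α + β + 2) - 1) := by positivity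
    have d : qY α β s + 2 * s * qv α β s < 0 := by
      have := mul_nonpos_of_nonneg_of_nonpos (by positivity : 0 ≤ 2 * s) b
      linarith
    have := mul_neg_of_pos_of_neg c d
    nlinarith
  intro s hs
  have hXs : 0 < s ^ (2 * (α + β + 2)) * qX α β s := by
    have := hX (Set.mem_Ici.2 le_rfl) (Set.mem_Ici.2 hs.le) hs
    simpa using this
  have hXs' : 0 < qX α β s := pos_of_mul_pos_right hXs (by positivity)
  have := qv_succ α β s
  by_contra hcon
  push Not at hcon
  have := mul_nonneg hs.le hcon
  linarith

lemma Is_even {φ : ℝ → ℝ} (h : ∀ t, φ (-t) = φ t) (s : ℝ) : Is φ s = 0 := by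
  have h1 : Is φ s = - Is φ s := by
    have e := intervalIntegral.integral_comp_neg (a := -1) (b := 1)
      (fun t => φ t * Real.sin (s * t))
    simp only [h, mul_neg, Real.sin_neg, neg_neg, intervalIntegral.integral_neg] at e
    exact e.symm
  linarith

lemma Ic_odd {φ : ℝ → ℝ} (h : ∀ t, φ (-t) = -φ t) (s : ℝ) : Ic φ s = 0 := by
  have h1 : Ic φ s = - Ic φ s := by
    have e := intervalIntegral.integral_comp_neg (a := -1) (b := 1)
      (fun t => φ t * Real.cos (s * t))
    simp only [h, mul_neg, Real.cos_neg, neg_neg, neg_mul, intervalIntegral.integral_neg] at e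
    exact e.symm
  linarith

lemma S0_diag (β : ℕ) (s : ℝ) : S0 β β s = 0 := Is_even (fun t => by simp only [bw]; ring) s
lemma C1_diag (β : ℕ) (s : ℝ) : C1 β β s = 0 := Ic_odd (fun t => by simp only [bw]; ring) s

lemma qv_base (β : ℕ) (s : ℝ) : s * qv (β + 1) β s = -((2 * (β : ℝ) + 2) * S1 β β s ^ 2) := by
  rw [qv_succ]
  unfold qX qw qr qu
  rw [S0_diag, C1_diag]
  ring

lemma S1_diag_pos (β : ℕ) (s : ℝ) (h0 : 0 < s) (h1 : s < 1) : 0 < S1 β β s := by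
  unfold S1 Is
  have hc := bw_cont β β
  have hsin : ∀ t : ℝ, t ∈ Set.Icc (-1 : ℝ) 1 → 0 ≤ t * Real.sin (s * t) := by
    intro t ht
    have hpi := Real.pi_gt_three
    rcases le_total 0 t with h | h
    · refine mul_nonneg h (Real.sin_nonneg_of_nonneg_of_le_pi (by positivity) ?_)
      nlinarith [ht.2]
    · refine mul_nonneg_of_nonpos_of_nonpos h
        (Real.sin_nonpos_of_nonpos_of_neg_pi_le (mul_nonpos_of_nonneg_of_nonpos h0.le h) ?_)
      nlinarith [ht.1]
  apply intervalIntegral.integral_pos (by norm_num)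
  · fun_prop
  · intro t ht
    have h := hsin t ⟨ht.1.le, ht.2⟩
    have hb : 0 ≤ bw β β t := by
      unfold bw
      have := ht.1
      have := ht.2
      exact mul_nonneg (pow_nonneg (by linarith) _) (pow_nonneg (by linarith) _)
    have := mul_nonneg hb h
    linarith [this, (by ring : bw β β t * (t * Real.sin (s * t)) = t * bw β β t * Real.sin (s * t))]
  · refine ⟨1 / 2, by norm_num, ?_⟩
    have hpi := Real.pi_gt_three
    have : 0 < Real.sin (s * (1 / 2)) := Real.sin_pos_of_pos_of_lt_pi (by positivity) (by linarith)
    have hb : 0 < bw β β (1 / 2) := by unfold bw; norm_num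
    positivity

lemma qv_neg (β d : ℕ) : ∀ s, 0 < s → qv (β + d + 2) β s < 0 := by
  induction d with
  | zero =>
    apply qv_step (α := β + 1) (by omega)
    · intro s hs
      have := qv_base β s
      have : s * qv (β + 1) β s ≤ 0 := by rw [this]; nlinarith [sq_nonneg (S1 β β s), (Nat.cast_nonneg β : (0:ℝ) ≤ β), mul_nonneg (Nat.cast_nonneg β : (0:ℝ) ≤ β) (sq_nonneg (S1 β β s))]
      exact nonpos_of_mul_nonpos_right this hs
    · intro s hs hs1
      have h := qv_base β s
      have hp := S1_diag_pos β s hs hs1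
      have : s * qv (β + 1) β s < 0 := by
        rw [h]
        have : 0 < (2 * (β : ℝ) + 2) * S1 β β s ^ 2 := by positivity
        linarith
      exact neg_of_mul_neg_right this hs.le
  | succ d ih =>
    exact qv_step (α := β + d + 2) (by omega) (fun s hs => (ih s hs).le) (fun s hs _ => ih s hs)

/-! ### The kernel of the cycloidal operator -/

/-- kernel of `D^(N+2) + D^N` -/
def Kc (N : ℕ) (F : ℝ → ℝ) : Prop :=
  ContDiff ℝ (⊤ : ℕ∞) F ∧ ∀ x : ℝ, iteratedDeriv (N + 2) F x + iteratedDeriv N F x = 0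

lemma mem_kerOp_iff (N : ℕ) (F : ℝ → ℝ) :
    F ∈ kerOp (N + 1) (trigCoeff (N + 1)) ↔ Kc N F := by
  unfold kerOp Kc trigCoeff
  simp only [Set.mem_ofPred_eq]
  have : ∀ x, ∑ i : Fin (N + 1 + 1), (if (i : ℕ) = N + 1 - 1 then (1 : ℝ) else 0) *
      iteratedDeriv (i : ℕ) F x = iteratedDeriv N F x := by
    intro x
    rw [Finset.sum_eq_single (⟨N, by omega⟩ : Fin (N + 1 + 1))]
    · simp
    · intro b _ hb
      have : (b : ℕ) ≠ N := fun h => hb (Fin.ext h)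
      simp [this]
    · simp
  simp only [this]

lemma smooth_iter {F : ℝ → ℝ} (hF : ContDiff ℝ (⊤ : ℕ∞) F) (j : ℕ) :
    ContDiff ℝ (⊤ : ℕ∞) (iteratedDeriv j F) := by
  rw [iteratedDeriv_eq_iterate]
  exact ContDiff.iterate_deriv j hF

lemma iter_hasDerivAt {F : ℝ → ℝ} (hF : ContDiff ℝ (⊤ : ℕ∞) F) (j : ℕ) (x : ℝ) :
    HasDerivAt (iteratedDeriv j F) (iteratedDeriv (j + 1) F x) x := by
  rw [iteratedDeriv_succ]
  exact ((smooth_iter hF j).differentiable (by simp) x).hasDerivAt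

lemma iter_iter (F : ℝ → ℝ) (i j : ℕ) :
    iteratedDeriv j (iteratedDeriv i F) = iteratedDeriv (i + j) F := by
  rw [iteratedDeriv_eq_iterate, iteratedDeriv_eq_iterate, iteratedDeriv_eq_iterate,
    add_comm i j, Function.iterate_add_apply]

lemma harmonic_rep {N : ℕ} {F : ℝ → ℝ} (hF : Kc N F) (a t : ℝ) :
    iteratedDeriv N F t = iteratedDeriv N F a * Real.cos (t - a) +
      iteratedDeriv (N + 1) F a * Real.sin (t - a) := by
  have hg := iter_hasDerivAt hF.1 N
  have hg' := iter_hasDerivAt hF.1 (N + 1)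
  have hs : ∀ x : ℝ, HasDerivAt (fun t => Real.sin (t - a)) (Real.cos (x - a)) x := fun x =>
    (((hasDerivAt_id x).sub_const a).sin).congr_deriv (by simp)
  have hc : ∀ x : ℝ, HasDerivAt (fun t => Real.cos (t - a)) (-Real.sin (x - a)) x := fun x =>
    (((hasDerivAt_id x).sub_const a).cos).congr_deriv (by simp)
  set P : ℝ → ℝ := iteratedDeriv N F * (fun t => Real.cos (t - a)) -
    iteratedDeriv (N + 1) F * (fun t => Real.sin (t - a)) with hP
  set R : ℝ → ℝ := iteratedDeriv N F * (fun t => Real.sin (t - a)) +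
    iteratedDeriv (N + 1) F * (fun t => Real.cos (t - a)) with hR
  have dP : ∀ x, HasDerivAt P 0 x := fun x =>
    (((hg x).mul (hc x)).sub ((hg' x).mul (hs x))).congr_deriv (by
      have := hF.2 x
      linear_combination -Real.sin (x - a) * this)
  have dR : ∀ x, HasDerivAt R 0 x := fun x =>
    (((hg x).mul (hs x)).add ((hg' x).mul (hc x))).congr_deriv (by
      have := hF.2 x
      linear_combination Real.cos (x - a) * this)
  have cP : P t = P a := is_const_of_deriv_eq_zero (fun x => (dP x).differentiableAt)
    (fun x => (dP x).deriv) t a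
  have cR : R t = R a := is_const_of_deriv_eq_zero (fun x => (dR x).differentiableAt)
    (fun x => (dR x).deriv) t a
  simp only [hP, hR, Pi.mul_apply, Pi.sub_apply, Pi.add_apply, sub_self, Real.cos_zero,
    Real.sin_zero, mul_one, mul_zero, sub_zero, zero_add] at cP cR
  have h1 := Real.sin_sq_add_cos_sq (t - a)
  linear_combination Real.cos (t - a) * cP + Real.sin (t - a) * cR - iteratedDeriv N F t * h1

lemma eq_zero_of_deriv_zero {F : ℝ → ℝ} (hF : Differentiable ℝ F) (h : ∀ x, deriv F x = 0)
    {a : ℝ} (ha : F a = 0) : ∀ x, F x = 0 := fun x =>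
  (is_const_of_deriv_eq_zero hF h x a).trans ha

/-- a function with `F^(N) = 0` and at least `N` zeros vanishes identically -/
lemma zero_of_iter_zero (N : ℕ) : ∀ (F : ℝ → ℝ), ContDiff ℝ (⊤ : ℕ∞) F →
    (∀ x, iteratedDeriv N F x = 0) → ∀ (T : Finset ℝ) (μ : ℝ → ℕ), ZerosIn F Set.univ T μ →
    N ≤ ∑ x ∈ T, μ x → ∀ x, F x = 0 := by
  induction N with
  | zero =>
    intro F _ h _ _ _ _ x
    simpa using h x
  | succ N ih =>
    intro F hF h T μ hT hN
    obtain ⟨T', μ', hT', hN'⟩ := rolle_count Set.ordConnected_univ hF.continuous.continuousOn hT hN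
    obtain ⟨a, _, ha⟩ := exists_zero_of_count hT hN
    have hd : ContDiff ℝ (⊤ : ℕ∞) (deriv F) := by
      have := smooth_iter hF 1
      rwa [iteratedDeriv_one] at this
    have := ih (deriv F) hd (by rw [← iteratedDeriv_succ']; exact h) T' μ' hT' hN'
    exact eq_zero_of_deriv_zero (hF.differentiable (by simp)) this ha

lemma rolle_iter {I : Set ℝ} (hI : I.OrdConnected) (M j : ℕ) : ∀ (F : ℝ → ℝ),
    ContDiff ℝ (⊤ : ℕ∞) F → ∀ (T : Finset ℝ) (μ : ℝ → ℕ), ZerosIn F I T μ →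
    M + j ≤ ∑ x ∈ T, μ x →
    ∃ (T' : Finset ℝ) (μ' : ℝ → ℕ), ZerosIn (iteratedDeriv j F) I T' μ' ∧ M ≤ ∑ x ∈ T', μ' x := by
  induction j with
  | zero => intro F _ T μ hT hN; exact ⟨T, μ, by simpa using hT, hN⟩
  | succ j ih =>
    intro F hF T μ hT hN
    obtain ⟨T', μ', hT', hN'⟩ := rolle_count (N := M + j) hI hF.continuous.continuousOn hT hN
    have hd : ContDiff ℝ (⊤ : ℕ∞) (deriv F) := by
      have := smooth_iter hF 1
      rwa [iteratedDeriv_one] at this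
    rw [iteratedDeriv_succ']
    exact ih (deriv F) hd T' μ' hT' hN'

lemma ZerosIn.mono {F : ℝ → ℝ} {I J : Set ℝ} {T : Finset ℝ} {μ : ℝ → ℕ} (h : ZerosIn F I T μ)
    (hIJ : I ⊆ J) : ZerosIn F J T μ := fun x hx => ⟨hIJ (h x hx).1, (h x hx).2⟩

lemma zero_of_small {N : ℕ} {F : ℝ → ℝ} (hF : Kc N F) {x : ℝ} (hx : x < Real.pi)
    {T : Finset ℝ} {μ : ℝ → ℕ} (hT : ZerosIn F (Set.Icc 0 x) T μ)
    (hN : N + 2 ≤ ∑ x ∈ T, μ x) : ∀ t, F t = 0 := by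
  obtain ⟨T', μ', hT', hN'⟩ := rolle_iter Set.ordConnected_Icc 2 N F hF.1 T μ hT (by omega)
  have hg : ∀ t, iteratedDeriv N F t = 0 := by
    by_cases h2 : ∃ a ∈ T', 2 ≤ μ' a
    · obtain ⟨a, ha, h2⟩ := h2
      have hv := (hT' a ha).2.2
      have h0 : iteratedDeriv N F a = 0 := by simpa using hv 0 (by omega)
      have h1 : iteratedDeriv (N + 1) F a = 0 := by
        have := hv 1 (by omega)
        rwa [iter_iter] at this
      intro t
      rw [harmonic_rep hF a t, h0, h1]; simp
    · push Not at h2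
      have hcard : ∑ x ∈ T', μ' x ≤ T'.card := by
        rw [Finset.card_eq_sum_ones]
        exact Finset.sum_le_sum fun i hi => by have := h2 i hi; omega
      obtain ⟨a, ha, b, hb, hab⟩ := Finset.one_lt_card.1 (by omega : 1 < T'.card)
      wlog hlt : a < b generalizing a b
      · exact this b hb a ha hab.symm (lt_of_le_of_ne (not_lt.1 hlt) hab.symm)
      obtain ⟨haI, ha1, hav⟩ := hT' a ha
      obtain ⟨hbI, hb1, hbv⟩ := hT' b hb
      have h0 := hav.val ha1
      have hb0 := hbv.val hb1
      have hr := harmonic_rep hF a b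
      rw [h0, hb0, zero_mul, zero_add] at hr
      have hsin : 0 < Real.sin (b - a) :=
        Real.sin_pos_of_pos_of_lt_pi (by linarith) (by linarith [haI.1, hbI.2])
      have h1 : iteratedDeriv (N + 1) F a = 0 :=
        (mul_eq_zero.1 hr.symm).resolve_right hsin.ne'
      intro t
      rw [harmonic_rep hF a t, h0, h1]; simp
  exact zero_of_iter_zero N F hF.1 hg T μ (hT.mono (Set.subset_univ _)) (by omega)

lemma zero_of_vanish {N : ℕ} {F : ℝ → ℝ} (hF : Kc N F) {a : ℝ}
    (h : VanishAtLeast F (N + 2) a) : ∀ t, F t = 0 := by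
  have hg : ∀ t, iteratedDeriv N F t = 0 := by
    intro t
    rw [harmonic_rep hF a t, h N (by omega), h (N + 1) (by omega)]; simp
  refine zero_of_iter_zero N F hF.1 hg {a} (fun _ => N + 2) ?_ (by simp)
  intro x hx
  rw [Finset.mem_singleton] at hx
  subst hx
  exact ⟨trivial, by simp, h⟩

lemma two_point_zeros {F : ℝ → ℝ} {p q : ℕ} {x : ℝ} (hx : 0 < x) (hp : 1 ≤ p) (hq : 1 ≤ q)
    (h0 : VanishAtLeast F p 0) (h1 : VanishAtLeast F q x) :
    ∃ (T : Finset ℝ) (μ : ℝ → ℕ), ZerosIn F (Set.Icc 0 x) T μ ∧ ∑ t ∈ T, μ t = p + q := by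
  refine ⟨{0, x}, fun t => if t = 0 then p else q, ?_, ?_⟩
  · intro t ht
    rcases Finset.mem_insert.1 ht with rfl | ht
    · simpa using ⟨hx.le, hp, h0⟩
    · rw [Finset.mem_singleton] at ht
      subst ht
      simpa [hx.ne'] using ⟨hx.le, hq, h1⟩
  · rw [Finset.sum_pair hx.ne]
    simp [ne_of_gt hx]

/-- the fundamental solution -/
def IsFund (N : ℕ) (S : ℝ → ℝ) : Prop :=
  Kc N S ∧ (∀ j < N + 1, iteratedDeriv j S 0 = 0) ∧ iteratedDeriv (N + 1) S 0 = 1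

lemma iter_comb {S : ℝ → ℝ} (hS : ContDiff ℝ (⊤ : ℕ∞) S) (c : ℕ → ℝ) (k j : ℕ) (x : ℝ) :
    iteratedDeriv j (comb (fun i => iteratedDeriv i S) c k) x =
      ∑ i ∈ Finset.range (k + 1), c i * iteratedDeriv (i + j) S x := by
  unfold comb
  rw [iteratedDeriv_fun_sum]
  · apply Finset.sum_congr rfl
    intro i _
    rw [iteratedDeriv_const_mul_field, iter_iter]
  · intro i _
    exact (contDiff_const.mul ((smooth_iter hS i).of_le (by exact_mod_cast le_top))).contDiffAt

lemma smooth_comb {S : ℝ → ℝ} (hS : ContDiff ℝ (⊤ : ℕ∞) S) (c : ℕ → ℝ) (k : ℕ) :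
    ContDiff ℝ (⊤ : ℕ∞) (comb (fun i => iteratedDeriv i S) c k) := by
  unfold comb
  apply ContDiff.sum
  intro i _
  exact contDiff_const.mul (smooth_iter hS i)

lemma iter_ker {N : ℕ} {S : ℝ → ℝ} (hS : Kc N S) (i : ℕ) (x : ℝ) :
    iteratedDeriv (i + (N + 2)) S x + iteratedDeriv (i + N) S x = 0 := by
  have h : (fun x => iteratedDeriv (N + 2) S x + iteratedDeriv N S x) = fun _ => 0 :=
    funext hS.2
  have h2 := congrArg (fun f => iteratedDeriv i f x) h
  simp only [iteratedDeriv_fun_const_zero] at h2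
  rw [show (fun x => iteratedDeriv (N + 2) S x + iteratedDeriv N S x) =
    iteratedDeriv (N + 2) S + iteratedDeriv N S from rfl,
    iteratedDeriv_add ((smooth_iter hS.1 _).of_le (by exact_mod_cast le_top)).contDiffAt
    ((smooth_iter hS.1 _).of_le (by exact_mod_cast le_top)).contDiffAt, iter_iter, iter_iter] at h2
  rw [add_comm i, add_comm i]
  exact h2

lemma comb_ker {N : ℕ} {S : ℝ → ℝ} (hS : Kc N S) (c : ℕ → ℝ) (k : ℕ) :
    Kc N (comb (fun i => iteratedDeriv i S) c k) := by
  refine ⟨smooth_comb hS.1 c k, fun x => ?_⟩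
  rw [iter_comb hS.1, iter_comb hS.1, ← Finset.sum_add_distrib]
  apply Finset.sum_eq_zero
  intro i _
  rw [← mul_add, iter_ker hS, mul_zero]

lemma comb_vanish_zero {N : ℕ} {S : ℝ → ℝ} (hS : IsFund N S) (c : ℕ → ℝ) (k : ℕ) :
    VanishAtLeast (comb (fun i => iteratedDeriv i S) c k) (N + 1 - k) 0 := by
  intro j hj
  rw [iter_comb hS.1.1]
  apply Finset.sum_eq_zero
  intro i hi
  rw [hS.2.1 (i + j) (by have := Finset.mem_range.1 hi; omega), mul_zero]

lemma comb_indep {N : ℕ} {S : ℝ → ℝ} (hS : IsFund N S) (c : ℕ → ℝ) (k : ℕ) :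
    k ≤ N + 1 → (∀ t, comb (fun i => iteratedDeriv i S) c k t = 0) → ∀ i ≤ k, c i = 0 := by
  induction k with
  | zero =>
    intro _ h i hi
    obtain rfl : i = 0 := by omega
    have h' : comb (fun i => iteratedDeriv i S) c 0 = fun _ => 0 := funext h
    have := iter_comb hS.1.1 c 0 (N + 1) 0
    rw [h', iteratedDeriv_fun_const_zero] at this
    simpa [hS.2.2] using this.symm
  | succ k ih =>
    intro hk h
    have h' : comb (fun i => iteratedDeriv i S) c (k + 1) = fun _ => 0 := funext h
    have e := iter_comb hS.1.1 c (k + 1) (N - k) 0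
    rw [h', iteratedDeriv_fun_const_zero, Finset.sum_range_succ, Finset.sum_eq_zero,
      show k + 1 + (N - k) = N + 1 by omega, hS.2.2] at e
    · have hc : c (k + 1) = 0 := by linarith
      intro i hi
      rcases Nat.lt_or_ge i (k + 1) with hlt | hge
      · refine ih (by omega) ?_ i (by omega)
        intro t
        have := h t
        unfold comb at this ⊢
        rw [Finset.sum_range_succ, hc, zero_mul, add_zero] at this
        exact this
      · rwa [show i = k + 1 by omega]
    · intro i hi
      rw [hS.2.1 _ (by have := Finset.mem_range.1 hi; omega), mul_zero]

lemma sub_ker {N : ℕ} {F G : ℝ → ℝ} (hF : Kc N F) (hG : Kc N G) (a : ℝ) :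
    Kc N (fun x => F x - a * G x) ∧
      ∀ j x, iteratedDeriv j (fun x => F x - a * G x) x =
        iteratedDeriv j F x - a * iteratedDeriv j G x := by
  have hj : ∀ j x, iteratedDeriv j (fun x => F x - a * G x) x =
        iteratedDeriv j F x - a * iteratedDeriv j G x := by
    intro j x
    rw [show (fun x => F x - a * G x) = F - fun x => a * G x from rfl,
      iteratedDeriv_sub (hF.1.of_le (by exact_mod_cast le_top)).contDiffAt
      (contDiff_const.mul (hG.1.of_le (by exact_mod_cast le_top))).contDiffAt,
      iteratedDeriv_const_mul_field]
  refine ⟨⟨hF.1.sub (contDiff_const.mul hG.1), fun x => ?_⟩, hj⟩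
  rw [hj, hj]
  linear_combination hF.2 x - a * hG.2 x

lemma iter_S_ker {N : ℕ} {S : ℝ → ℝ} (hS : Kc N S) (i : ℕ) : Kc N (iteratedDeriv i S) := by
  refine ⟨smooth_iter hS.1 i, fun x => ?_⟩
  rw [iter_iter, iter_iter]
  exact iter_ker hS i x

lemma comb_rep {N : ℕ} {S : ℝ → ℝ} (hS : IsFund N S) (k : ℕ) : ∀ (F : ℝ → ℝ), Kc N F →
    k ≤ N + 1 → VanishAtLeast F (N + 1 - k) 0 →
    ∃ c : ℕ → ℝ, ∀ t, F t = comb (fun i => iteratedDeriv i S) c k t := by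
  induction k with
  | zero =>
    intro F hF _ hv
    obtain ⟨h1, h2⟩ := sub_ker hF hS.1 (iteratedDeriv (N + 1) F 0)
    have := zero_of_vanish h1 (a := 0) (by
      intro j hj
      rw [h2]
      rcases Nat.lt_or_ge j (N + 1) with hlt | hge
      · rw [hv j (by omega), hS.2.1 j hlt]; ring
      · rw [show j = N + 1 by omega, hS.2.2]; ring)
    refine ⟨fun _ => iteratedDeriv (N + 1) F 0, fun t => ?_⟩
    have := this t
    simp [comb]
    linarith
  | succ k ih =>
    intro F hF hk hv
    obtain ⟨h1, h2⟩ := sub_ker hF (iter_S_ker hS.1 (k + 1)) (iteratedDeriv (N - k) F 0)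
    obtain ⟨c, hc⟩ := ih _ h1 (by omega) (by
      intro j hj
      rw [h2, iter_iter]
      rcases Nat.lt_or_ge j (N - k) with hlt | hge
      · rw [hv j (by omega), hS.2.1 _ (by omega)]; ring
      · rw [show j = N - k by omega, show k + 1 + (N - k) = N + 1 by omega, hS.2.2]; ring)
    refine ⟨fun i => if i ≤ k then c i else iteratedDeriv (N - k) F 0, fun t => ?_⟩
    have := hc t
    unfold comb at this ⊢
    beta_reduce at this ⊢
    rw [Finset.sum_range_succ, if_neg (by omega)]
    rw [Finset.sum_congr rfl (g := fun i => c i * iteratedDeriv i S t) (by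
      intro i hi
      rw [if_pos (by have := Finset.mem_range.1 hi; omega)])]
    linarith

lemma wron_zero_iff {S : ℝ → ℝ} (hS : ContDiff ℝ (⊤ : ℕ∞) S) (k : ℕ) (x : ℝ) :
    WronS S k x = 0 ↔ ∃ c : ℕ → ℝ, (∃ i ≤ k, c i ≠ 0) ∧
      VanishAtLeast (comb (fun i => iteratedDeriv i S) c k) (k + 1) x := by
  unfold WronS
  rw [← Matrix.exists_mulVec_eq_zero_iff]
  constructor
  · rintro ⟨v, hv, hM⟩
    refine ⟨fun i => if h : i < k + 1 then v ⟨i, h⟩ else 0, ?_, ?_⟩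
    · by_contra hcon
      push Not at hcon
      apply hv
      ext i
      have := hcon i (by omega)
      rw [dif_pos i.2] at this
      exact this
    · intro j hj
      rw [iter_comb hS, Finset.sum_range]
      have := congrFun hM ⟨j, hj⟩
      simp only [Matrix.mulVec, dotProduct, Matrix.of_apply, Pi.zero_apply] at this
      refine Eq.trans (Finset.sum_congr rfl fun i _ => ?_) this
      rw [dif_pos i.2, mul_comm, add_comm]
  · rintro ⟨c, ⟨i, hi, hci⟩, hv⟩
    refine ⟨fun i => c i, ?_, ?_⟩
    · intro h
      exact hci (congrFun h ⟨i, by omega⟩)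
    · ext j
      have := hv j j.2
      rw [iter_comb hS, Finset.sum_range] at this
      simp only [Matrix.mulVec, dotProduct, Matrix.of_apply, Pi.zero_apply]
      rw [← this]
      apply Finset.sum_congr rfl
      intro i _
      simp [add_comm, mul_comm]

/-- Zeros of the Wronskian as two-point problems -/
lemma wron_zero_iff' {N : ℕ} {S : ℝ → ℝ} (hS : IsFund N S) {k : ℕ} (hk : k ≤ N + 1) (x : ℝ) :
    WronS S k x = 0 ↔ ∃ F : ℝ → ℝ, Kc N F ∧ F ≠ 0 ∧ VanishAtLeast F (N + 1 - k) 0 ∧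
      VanishAtLeast F (k + 1) x := by
  rw [wron_zero_iff hS.1.1]
  constructor
  · rintro ⟨c, ⟨i, hi, hci⟩, hv⟩
    refine ⟨_, comb_ker hS.1 c k, ?_, comb_vanish_zero hS c k, hv⟩
    intro h
    exact hci (comb_indep hS c k hk (fun t => congrFun h t) i hi)
  · rintro ⟨F, hF, hF0, h0, h1⟩
    obtain ⟨c, hc⟩ := comb_rep hS k F hF hk h0
    have hc' : F = _ := funext hc
    refine ⟨c, ?_, hc' ▸ h1⟩
    by_contra hcon
    push Not at hcon
    apply hF0
    rw [hc']
    ext t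
    unfold comb
    exact Finset.sum_eq_zero fun i hi => by
      rw [hcon i (by have := Finset.mem_range.1 hi; omega), zero_mul]

lemma reflect_ker {N : ℕ} {F : ℝ → ℝ} (hF : Kc N F) (x : ℝ) : Kc N (fun t => F (x - t)) := by
  refine ⟨hF.1.comp (contDiff_const.sub contDiff_id), fun t => ?_⟩
  rw [iteratedDeriv_comp_const_sub, iteratedDeriv_comp_const_sub]
  simp only [smul_eq_mul, pow_add]
  linear_combination (-1) ^ N * hF.2 (x - t)

lemma wron_reflect {N : ℕ} {S : ℝ → ℝ} (hS : IsFund N S) {k : ℕ} (hk : k ≤ N) (x : ℝ)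
    (h : WronS S k x = 0) : WronS S (N - k) x = 0 := by
  rw [wron_zero_iff' hS (by omega)] at h ⊢
  obtain ⟨F, hF, hF0, h0, h1⟩ := h
  refine ⟨fun t => F (x - t), reflect_ker hF x, ?_, ?_, ?_⟩
  · intro h
    apply hF0
    ext t
    have := congrFun h (x - t)
    simpa using this
  · intro j hj
    rw [iteratedDeriv_comp_const_sub]
    simp only [sub_zero]
    rw [h1 j (by omega), smul_zero]
  · intro j hj
    rw [iteratedDeriv_comp_const_sub]
    simp only [sub_self]
    rw [h0 j (by omega), smul_zero]

lemma wron_small {N : ℕ} {S : ℝ → ℝ} (hS : IsFund N S) {k : ℕ} (hk : k ≤ N) {x : ℝ}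
    (hx : 0 < x) (hxp : x < Real.pi) : WronS S k x ≠ 0 := by
  intro h
  rw [wron_zero_iff' hS (by omega)] at h
  obtain ⟨F, hF, hF0, h0, h1⟩ := h
  obtain ⟨T, μ, hT, hs⟩ := two_point_zeros hx (by omega) (by omega) h0 h1
  exact hF0 (funext (zero_of_small hF hxp hT (by omega)))

/-! ### No zeros for the small Wronskians -/

lemma pos_of_hasDerivAt_pos {f f' : ℝ → ℝ} (hd : ∀ x, HasDerivAt f (f' x) x) (h0 : f 0 = 0)
    (hp : ∀ x, 0 < x → 0 < f' x) : ∀ x, 0 < x → 0 < f x := by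
  have hmono : StrictMonoOn f (Set.Ici 0) := by
    apply strictMonoOn_of_deriv_pos (convex_Ici 0)
    · exact (continuous_iff_continuousAt.2 fun x => (hd x).continuousAt).continuousOn
    · intro x hx
      rw [interior_Ici] at hx
      rw [(hd x).deriv]
      exact hp x hx
  intro x hx
  have := hmono (Set.mem_Ici.2 le_rfl) (Set.mem_Ici.2 hx.le) hx
  rwa [h0] at this

lemma eq_of_hasDerivAt_eq {f g f' : ℝ → ℝ} (hf : ∀ x, HasDerivAt f (f' x) x)
    (hg : ∀ x, HasDerivAt g (f' x) x) (h0 : f 0 = g 0) : ∀ x, f x = g x := by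
  intro x
  have hd : ∀ x, HasDerivAt (f - g) 0 x := fun x => ((hf x).sub (hg x)).congr_deriv (sub_self _)
  have := is_const_of_deriv_eq_zero (fun x => (hd x).differentiableAt) (fun x => (hd x).deriv) x 0
  simp only [Pi.sub_apply, h0, sub_self] at this
  linarith

lemma S_pos {M : ℕ} {S : ℝ → ℝ} (hS : IsFund (M + 2) S) (x : ℝ) (hx : 0 < x) : 0 < S x := by
  have h2 : ∀ t, iteratedDeriv (M + 2) S t = Real.sin t := by
    intro t
    rw [harmonic_rep hS.1 0 t, hS.2.1 _ (by omega), hS.2.2]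
    simp
  have h1 : ∀ t, iteratedDeriv (M + 1) S t = 1 - Real.cos t := by
    apply eq_of_hasDerivAt_eq (iter_hasDerivAt hS.1.1 (M + 1))
    · intro t
      rw [h2]
      exact ((Real.hasDerivAt_cos t).const_sub 1).congr_deriv (by simp)
    · rw [hS.2.1 _ (by omega)]; simp
  have h0 : ∀ t, iteratedDeriv M S t = t - Real.sin t := by
    apply eq_of_hasDerivAt_eq (iter_hasDerivAt hS.1.1 M)
    · intro t
      rw [h1]
      exact (hasDerivAt_id t).sub (Real.hasDerivAt_sin t)
    · rw [hS.2.1 _ (by omega)]; simp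
  have key : ∀ j ≤ M, ∀ t, 0 < t → 0 < iteratedDeriv (M - j) S t := by
    intro j
    induction j with
    | zero =>
      intro _ t ht
      rw [Nat.sub_zero, h0]
      linarith [Real.sin_lt ht]
    | succ j ih =>
      intro hj
      refine pos_of_hasDerivAt_pos (iter_hasDerivAt hS.1.1 _) (hS.2.1 _ (by omega)) ?_
      rw [show M - (j + 1) + 1 = M - j by omega]
      exact ih (by omega)
  have := key M le_rfl x hx
  simpa using this

lemma ibp {F : ℝ → ℝ} (hF : ContDiff ℝ (⊤ : ℕ∞) F) (x : ℝ) (N : ℕ) : ∀ P : Polynomial ℝ,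
    (Polynomial.derivative^[N] P = 0) →
    (∀ i < N, iteratedDeriv (N - 1 - i) F 0 * (Polynomial.derivative^[i] P).eval 0 = 0) →
    (∀ i < N, iteratedDeriv (N - 1 - i) F x * (Polynomial.derivative^[i] P).eval x = 0) →
    ∫ t in (0 : ℝ)..x, P.eval t * iteratedDeriv N F t = 0 := by
  induction N with
  | zero =>
    intro P hP _ _
    simp only [Function.iterate_zero, id] at hP
    simp [hP]
  | succ N ih =>
    intro P hP h0 hx
    have hib := intervalIntegral.integral_mul_deriv_eq_deriv_mul (a := 0) (b := x)
      (u := fun t => P.eval t) (u' := fun t => P.derivative.eval t) (v := iteratedDeriv N F)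
      (v' := iteratedDeriv (N + 1) F) (fun t _ => P.hasDerivAt t)
      (fun t _ => iter_hasDerivAt hF N t)
      (P.derivative.continuous.intervalIntegrable _ _)
      ((smooth_iter hF (N + 1)).continuous.intervalIntegrable _ _)
    rw [hib, ih P.derivative]
    · have a0 := h0 0 (by omega)
      have ax := hx 0 (by omega)
      simp only [Nat.add_sub_cancel, Nat.sub_zero, Function.iterate_zero, id] at a0 ax
      linear_combination ax - a0
    · rw [← Function.iterate_succ_apply]; exact hP
    · intro i hi
      rw [← Function.iterate_succ_apply]
      have := h0 (i + 1) (by omega)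
      rwa [show N + 1 - 1 - (i + 1) = N - 1 - i by omega] at this
    · intro i hi
      rw [← Function.iterate_succ_apply]
      have := hx (i + 1) (by omega)
      rwa [show N + 1 - 1 - (i + 1) = N - 1 - i by omega] at this

lemma eval_iter_derivative_zero {P : Polynomial ℝ} {a : ℝ} {m i : ℕ}
    (h : (Polynomial.X - Polynomial.C a) ^ m ∣ P) (hi : i < m) :
    (Polynomial.derivative^[i] P).eval a = 0 := by
  have h1 := Polynomial.pow_sub_dvd_iterate_derivative_of_pow_dvd i h
  have h2 : (Polynomial.X - Polynomial.C a) ∣ Polynomial.derivative^[i] P :=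
    (dvd_pow_self _ (by omega)).trans h1
  exact Polynomial.dvd_iff_isRoot.1 h2

lemma moment {N k e : ℕ} {F : ℝ → ℝ} (hF : Kc N F) {y : ℝ} (hy : 0 < y) (hk : 1 ≤ k)
    (hkN : k + 1 ≤ N) (he : e ≤ 1) (h0 : VanishAtLeast F (N + 1 - k) 0)
    (h1 : VanishAtLeast F (k + 1) (2 * y)) :
    iteratedDeriv N F y * Ic (fun t => t ^ e * bw (N - 1 - k) (k - 1) t) y +
      iteratedDeriv (N + 1) F y * Is (fun t => t ^ e * bw (N - 1 - k) (k - 1) t) y = 0 := by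
  set α := N - 1 - k with hα
  set β := k - 1 with hβ
  set P : Polynomial ℝ := (Polynomial.X - Polynomial.C (2 * y)) ^ α *
    (Polynomial.X - Polynomial.C 0) ^ β * (Polynomial.X - Polynomial.C y) ^ e with hP
  have hI : ∫ t in (0 : ℝ)..(2 * y), P.eval t * iteratedDeriv N F t = 0 := by
    apply ibp hF.1
    · apply Polynomial.iterate_derivative_eq_zero
      have : P.natDegree ≤ α * 1 + β * 1 + e * 1 := by
        refine Polynomial.natDegree_mul_le.trans (add_le_add (Polynomial.natDegree_mul_le.trans
          (add_le_add ?_ ?_)) ?_) <;>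
        exact Polynomial.natDegree_pow_le_of_le _ (Polynomial.natDegree_X_sub_C_le _)
      omega
    · intro i hi
      rcases Nat.lt_or_ge i β with hlt | hge
      · rw [eval_iter_derivative_zero (m := β) _ hlt, mul_zero]
        exact ((dvd_mul_left _ _).mul_right _)
      · rw [h0 _ (by omega), zero_mul]
    · intro i hi
      rcases Nat.lt_or_ge i α with hlt | hge
      · rw [eval_iter_derivative_zero (m := α) _ hlt, mul_zero]
        exact ((dvd_mul_right _ _).mul_right _)
      · rw [h1 _ (by omega), zero_mul]
  have hsub := intervalIntegral.mul_integral_comp_add_mul (a := -1) (b := 1)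
    (f := fun t => P.eval t * iteratedDeriv N F t) y y
  rw [show y + y * -1 = 0 by ring, show y + y * 1 = 2 * y by ring, hI] at hsub
  have hz := (mul_eq_zero.1 hsub).resolve_left hy.ne'
  set A := iteratedDeriv N F y
  set B := iteratedDeriv (N + 1) F y
  set φ : ℝ → ℝ := fun t => t ^ e * bw α β t with hφ
  have hφc : Continuous φ := by
    simp only [hφ, bw]
    fun_prop
  have hK : (-1) ^ α * y ^ (α + β + e) ≠ 0 :=
    mul_ne_zero (pow_ne_zero _ (by norm_num)) (pow_ne_zero _ hy.ne')
  have heq : ∀ τ, (P.eval (y + y * τ) * iteratedDeriv N F (y + y * τ)) =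
      ((-1) ^ α * y ^ (α + β + e)) * (A * (φ τ * Real.cos (y * τ)) +
        B * (φ τ * Real.sin (y * τ))) := by
    intro τ
    rw [harmonic_rep hF y (y + y * τ)]
    have : P.eval (y + y * τ) = ((-1) ^ α * y ^ (α + β + e)) * φ τ := by
      simp only [hP, hφ, bw, Polynomial.eval_mul, Polynomial.eval_pow, Polynomial.eval_sub,
        Polynomial.eval_X, Polynomial.eval_C]
      rw [show y + y * τ - 2 * y = -1 * (y * (1 - τ)) by ring,
        show y + y * τ - 0 = y * (1 + τ) by ring, show y + y * τ - y = y * τ by ring]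
      simp only [mul_pow, pow_add]
      ring
    rw [this, show y + y * τ - y = y * τ by ring]
    ring
  simp only [heq] at hz
  rw [intervalIntegral.integral_const_mul, intervalIntegral.integral_add,
    intervalIntegral.integral_const_mul, intervalIntegral.integral_const_mul] at hz
  · exact (mul_eq_zero.1 hz).resolve_left hK
  · exact Continuous.intervalIntegrable (by fun_prop) _ _
  · exact Continuous.intervalIntegrable (by fun_prop) _ _

lemma wron_ne_zero {N : ℕ} {S : ℝ → ℝ} (hS : IsFund N S) {k : ℕ} (hk : k < N / 2) {x : ℝ}
    (hx : 0 < x) : WronS S k x ≠ 0 := by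
  rcases Nat.eq_zero_or_pos k with rfl | hkpos
  · obtain ⟨M, rfl⟩ : ∃ M, N = M + 2 := ⟨N - 2, by omega⟩
    have := S_pos hS x hx
    have hW : WronS S 0 x = S x := by
      unfold WronS
      exact (Matrix.det_fin_one _).trans (by simp)
    rw [hW]
    exact this.ne'
  · intro h
    rw [wron_zero_iff' hS (by omega)] at h
    obtain ⟨F, hF, hF0, h0, h1⟩ := h
    have hy : 0 < x / 2 := by linarith
    have hx2 : x = 2 * (x / 2) := by ring
    have h1' := h1
    rw [hx2] at h1'
    have m0 := moment (e := 0) hF hy hkpos (by omega) (by omega) h0 h1'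
    have m1 := moment (e := 1) hF hy hkpos (by omega) (by omega) h0 h1'
    simp only [pow_zero, one_mul, pow_one] at m0 m1
    obtain ⟨β, hβ⟩ : ∃ β, k - 1 = β := ⟨_, rfl⟩
    obtain ⟨d, hd⟩ : ∃ d, N - 1 - k = β + d + 2 := ⟨N - 2 * k - 2, by omega⟩
    rw [hβ, hd] at m0 m1
    have hq := qv_neg β d (x / 2) hy
    change _ * C0 (β + d + 2) β (x / 2) + _ * S0 (β + d + 2) β (x / 2) = 0 at m0
    change _ * C1 (β + d + 2) β (x / 2) + _ * S1 (β + d + 2) β (x / 2) = 0 at m1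
    unfold qv at hq
    have hA : iteratedDeriv N F (x / 2) = 0 := by
      refine (mul_eq_zero.1 ?_).resolve_right hq.ne
      linear_combination (-S1 (β + d + 2) β (x / 2)) * m0 + S0 (β + d + 2) β (x / 2) * m1
    have hB : iteratedDeriv (N + 1) F (x / 2) = 0 := by
      refine (mul_eq_zero.1 ?_).resolve_right hq.ne
      linear_combination (C1 (β + d + 2) β (x / 2)) * m0 - C0 (β + d + 2) β (x / 2) * m1
    have hg : ∀ t, iteratedDeriv N F t = 0 := by
      intro t
      rw [harmonic_rep hF (x / 2) t, hA, hB]; simp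
    obtain ⟨T, μ, hT, hs⟩ := two_point_zeros hx (by omega) (by omega) h0 h1
    exact hF0 (funext (zero_of_iter_zero N F hF.1 hg T μ (hT.mono (Set.subset_univ _)) (by omega)))

/-! ### The critical length -/

lemma zeros_bound {N : ℕ} {S : ℝ → ℝ} (hS : IsFund N S) {b : ℝ}
    (hW : ∀ k ≤ N, ∀ x ∈ Set.Ioo 0 b, WronS S k x ≠ 0) {F : ℝ → ℝ} (hF : Kc N F) (hF0 : F ≠ 0)
    {m : ℕ} (hm : m ≤ N + 2) (hv : VanishAtLeast F m 0) {T : Finset ℝ} {μ : ℝ → ℕ}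
    (hT : ZerosIn F (Set.Ioo 0 b) T μ) : m + ∑ t ∈ T, μ t ≤ N + 1 := by
  rcases Nat.lt_or_ge m (N + 2) with hlt | hge
  · obtain ⟨c, hc⟩ := comb_rep hS (N + 1 - m) F hF (by omega)
      (by rwa [show N + 1 - (N + 1 - m) = m by omega])
    have hc' : F = comb (fun i => iteratedDeriv i S) c (N + 1 - m) := funext hc
    by_contra hcon
    have hz := polya Set.ordConnected_Ioo isOpen_Ioo (N + 1 - m) (fun i => iteratedDeriv i S)
      (fun i _ => (smooth_iter hS.1.1 i).contDiffOn) (by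
        intro j hj c x hx hvan
        rcases Nat.lt_or_ge N j with hNj | hjN
        · obtain rfl : j = N + 1 := by omega
          exact comb_indep hS c (N + 1) le_rfl (zero_of_vanish (comb_ker hS.1 c (N + 1)) hvan)
        · by_contra hne
          push Not at hne
          exact hW j hjN x hx ((wron_zero_iff hS.1.1 j x).2 ⟨c, hne, hvan⟩))
      c T μ (hc' ▸ hT) (by omega)
    apply hF0
    rw [hc']
    ext t
    unfold comb
    exact Finset.sum_eq_zero fun i hi => by
      rw [hz i (by have := Finset.mem_range.1 hi; omega), zero_mul]
  · exfalso
    obtain rfl : m = N + 2 := by omega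
    exact hF0 (funext (zero_of_vanish hF hv))

lemma ec_of_wron {N : ℕ} {S : ℝ → ℝ} (hS : IsFund N S) {b : ℝ}
    (hW : ∀ x ∈ Set.Ioo 0 b, WronS S (N / 2) x ≠ 0) {h : ℝ} (hh : h < b) :
    IsECOn (N + 1) (trigCoeff (N + 1)) (Set.Icc 0 h) := by
  have hall : ∀ k ≤ N, ∀ x ∈ Set.Ioo 0 b, WronS S k x ≠ 0 := by
    intro k hk x hx
    have hsmall : ∀ k ≤ N / 2, WronS S k x ≠ 0 := by
      intro k hk
      rcases Nat.lt_or_ge k (N / 2) with hlt | hge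
      · exact wron_ne_zero hS hlt hx.1
      · rw [show k = N / 2 by omega]
        exact hW x hx
    rcases Nat.lt_or_ge (N / 2) k with hlt | hge
    · intro h0
      exact hsmall (N - k) (by omega) (wron_reflect hS hk x h0)
    · exact hsmall k hge
  intro F hF hF0 r xs m hxs hinj hm1 hm2 hv
  rw [mem_kerOp_iff] at hF
  set μ : ℝ → ℕ := Function.extend xs m 0 with hμ
  have hμx : ∀ i, μ (xs i) = m i := fun i => hinj.extend_apply m 0 i
  set A := Finset.univ.image xs with hA
  have hsum : ∑ i, m i = ∑ t ∈ A, μ t := by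
    rw [hA, Finset.sum_image (fun i _ j _ hij => hinj hij)]
    exact Finset.sum_congr rfl fun i _ => (hμx i).symm
  have hT : ZerosIn F (Set.Ioo 0 b) (A.erase 0) μ := by
    intro t ht
    obtain ⟨ht0, htA⟩ := Finset.mem_erase.1 ht
    obtain ⟨i, _, rfl⟩ := Finset.mem_image.1 htA
    rw [hμx]
    exact ⟨⟨lt_of_le_of_ne (hxs i).1 ht0.symm, lt_of_le_of_lt (hxs i).2 hh⟩, hm1 i, hv i⟩
  rw [hsum]
  by_cases h0 : (0 : ℝ) ∈ A
  · rw [← Finset.add_sum_erase A μ h0]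
    obtain ⟨i, _, hi⟩ := Finset.mem_image.1 h0
    refine zeros_bound hS hall hF hF0 ?_ ?_ hT
    · rw [← hi, hμx]; exact hm2 i
    · rw [← hi, hμx]; exact hv i
  · rw [Finset.erase_eq_of_notMem h0] at hT
    have := zeros_bound hS hall hF hF0 (m := 0) (by omega) (fun j hj => by omega) hT
    omega

lemma not_ec_of_wron_zero {N : ℕ} {S : ℝ → ℝ} (hS : IsFund N S) {k : ℕ} (hk : k ≤ N) {x h : ℝ}
    (hx : 0 < x) (hW : WronS S k x = 0) (hh : x ≤ h) :
    ¬ IsECOn (N + 1) (trigCoeff (N + 1)) (Set.Icc 0 h) := by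
  intro hE
  rw [wron_zero_iff' hS (by omega)] at hW
  obtain ⟨F, hF, hF0, h0, h1⟩ := hW
  have := hE F ((mem_kerOp_iff N F).2 hF) hF0 2 ![0, x] ![N + 1 - k, k + 1] (by
      intro i; fin_cases i
      · simpa using hx.le.trans hh
      · simpa using ⟨hx.le, hh⟩) (by
      intro i j hij
      fin_cases i <;> fin_cases j <;> simp_all [hx.ne, hx.ne']) (by
      intro i; fin_cases i
      · simp; omega
      · simp) (by
      intro i; fin_cases i
      · simp; omega
      · simp; omega) (by
      intro i; fin_cases i
      · simpa using h0
      · simpa using h1)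
  rw [Fin.sum_univ_two] at this
  simp only [Matrix.cons_val_zero, Matrix.cons_val_one] at this
  omega

lemma sin_ker (N : ℕ) : Kc N Real.sin := by
  refine ⟨Real.contDiff_sin, fun x => ?_⟩
  have h2 : iteratedDeriv 2 Real.sin = fun x => - Real.sin x := by
    rw [iteratedDeriv_succ, iteratedDeriv_one, Real.deriv_sin]
    ext x
    simp
  rw [show N + 2 = 2 + N by omega, ← iter_iter, h2, iteratedDeriv_fun_neg]
  ring

lemma not_ec_large (N : ℕ) :
    ¬ IsECOn (N + 1) (trigCoeff (N + 1)) (Set.Icc 0 ((N + 1 : ℝ) * Real.pi)) := by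
  intro hE
  have hne : Real.sin ≠ 0 := by
    intro h
    have := congrFun h (Real.pi / 2)
    simp at this
  have := hE Real.sin ((mem_kerOp_iff N _).2 (sin_ker N)) hne (N + 2) (fun i => (i : ℝ) * Real.pi)
    (fun _ => 1) (by
      intro i
      refine ⟨by positivity, ?_⟩
      have : ((i : ℕ) : ℝ) ≤ N + 1 := by exact_mod_cast (by omega : (i : ℕ) ≤ N + 1)
      exact mul_le_mul_of_nonneg_right this Real.pi_pos.le) (by
      intro i j hij
      have := mul_right_cancel₀ Real.pi_pos.ne' hij
      exact Fin.ext (by exact_mod_cast this)) (by simp) (by simp) (by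
      intro i j hj
      obtain rfl : j = 0 := by omega
      rw [iteratedDeriv_zero]
      exact Real.sin_nat_mul_pi i)
  simp at this

lemma wron_continuous {S : ℝ → ℝ} (hS : ContDiff ℝ (⊤ : ℕ∞) S) (k : ℕ) :
    Continuous (WronS S k) := by
  unfold WronS
  apply Continuous.matrix_det
  apply continuous_matrix
  intro i j
  exact (smooth_iter hS _).continuous

lemma main_aux {N : ℕ} {S : ℝ → ℝ} (hS : IsFund N S) :
    ∃ ℓ : ℝ, 0 < ℓ ∧ critLen (N + 1) (trigCoeff (N + 1)) = (ℓ : EReal) ∧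
      WronS S (N / 2) ℓ = 0 ∧ (∀ x : ℝ, 0 < x → x < ℓ → WronS S (N / 2) x ≠ 0) := by
  set Z : Set ℝ := {x | Real.pi ≤ x ∧ WronS S (N / 2) x = 0} with hZ
  have hpN : N / 2 ≤ N := Nat.div_le_self _ _
  have hZmem : ∀ x, 0 < x → WronS S (N / 2) x = 0 → x ∈ Z := by
    intro x hx hW
    refine ⟨?_, hW⟩
    by_contra hlt
    exact wron_small hS hpN hx (not_le.1 hlt) hW
  have hZne : Z.Nonempty := by
    by_contra hempty
    refine not_ec_large N (ec_of_wron hS (b := (N + 1 : ℝ) * Real.pi + 1) ?_ (by linarith))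
    intro x hx hW
    exact hempty ⟨x, hZmem x hx.1 hW⟩
  have hZcl : IsClosed Z :=
    (isClosed_le continuous_const continuous_id).inter
      (isClosed_eq (wron_continuous hS.1.1 _) continuous_const)
  have hZbdd : BddBelow Z := ⟨Real.pi, fun x hx => hx.1⟩
  have hmem := hZcl.csInf_mem hZne hZbdd
  set ℓ := sInf Z with hℓ
  have hpos : 0 < ℓ := Real.pi_pos.trans_le hmem.1
  have hfirst : ∀ x : ℝ, 0 < x → x < ℓ → WronS S (N / 2) x ≠ 0 := fun x hx hxl hW =>
    absurd (csInf_le hZbdd (hZmem x hx hW)) (not_le.2 hxl)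
  refine ⟨ℓ, hpos, ?_, hmem.2, hfirst⟩
  unfold critLen
  apply le_antisymm
  · apply sSup_le
    rintro l ⟨h, rfl, hh, hE⟩
    rw [EReal.coe_le_coe_iff]
    by_contra hlt
    exact not_ec_of_wron_zero hS hpN hpos hmem.2 (not_le.1 hlt).le hE
  · apply le_of_forall_lt
    intro c hc
    obtain ⟨h, hch, hhl⟩ := EReal.lt_iff_exists_real_btwn.1
      (max_lt hc (EReal.coe_lt_coe_iff.2 hpos) : max c ((0 : ℝ) : EReal) < ℓ)
    have h0 : 0 < h := EReal.coe_lt_coe_iff.1 ((le_max_right _ _).trans_lt hch)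
    have hl : h < ℓ := EReal.coe_lt_coe_iff.1 hhl
    refine lt_of_lt_of_le ((le_max_left _ _).trans_lt hch) (le_sSup ⟨h, rfl, h0, ?_⟩)
    exact ec_of_wron hS (fun x hx => hfirst x hx.1 hx.2) hl

/-- for the cycloidal operator `L_n = D^(n+1) + D^(n-1)`, with `p = ⌊(n-1)/2⌋`,
the critical length `ℓ_n` is the first positive zero of the Wronskian `W_p` of
`(S_n, …, S_n^(p))`, and for every `k < p` the Wronskian `W_k` has no zero in `(0, ∞)`. -/
theorem stmt6 (n : ℕ) (hn : 1 ≤ n) (S : ℝ → ℝ) (hS : S ∈ kerOp n (trigCoeff n))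
    (hS0 : ∀ j < n, iteratedDeriv j S 0 = 0) (hSn : iteratedDeriv n S 0 = 1) :
    ∃ ℓ : ℝ, 0 < ℓ ∧ critLen n (trigCoeff n) = (ℓ : EReal) ∧
      WronS S ((n - 1) / 2) ℓ = 0 ∧
      (∀ x : ℝ, 0 < x → x < ℓ → WronS S ((n - 1) / 2) x ≠ 0) ∧
      ∀ k < (n - 1) / 2, ∀ x : ℝ, 0 < x → WronS S k x ≠ 0 := by
  obtain ⟨N, rfl⟩ : ∃ N, n = N + 1 := ⟨n - 1, by omega⟩
  have hF : IsFund N S := ⟨(mem_kerOp_iff N S).1 hS, hS0, hSn⟩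
  rw [Nat.add_sub_cancel]
  obtain ⟨ℓ, h1, h2, h3, h4⟩ := main_aux hF
  exact ⟨ℓ, h1, h2, h3, h4, fun k hk x hx => wron_ne_zero hF hk hx⟩
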